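/- A planar Jordan domain Ω satisfies the level chord-arc property if and only if Ω has the level quasicircle property and ∂Ω is a chord-arc curve. -/

import Mathlib

open Metric Set MeasureTheory

noncomputable section

/-- The Euclidean plane. -/
abbrev E2 : Type := EuclideanSpace ℝ (Fin 2)
/-- Euclidean three-space. -/
abbrev E3 : Type := EuclideanSpace ℝ (Fin 3)

/-- Build a point of ℝ³ from a planar point and a height. -/
def mk3 (x : E2) (z : ℝ) : E3 := (WithLp.equiv 2 (Fin 3 → ℝ)).symm ![x 0, x 1, z]

/-- A Jordan curve: the image of the unit circle under a continuous injection
(equivalently, a topological embedding, by compactness of the circle). -/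
def IsJordanCurve (Γ : Set E2) : Prop :=
  ∃ f : E2 → E2, ContinuousOn f (sphere 0 1) ∧ InjOn f (sphere 0 1) ∧ f '' (sphere 0 1) = Γ

/-- A Jordan domain: a bounded domain whose boundary is a Jordan curve. -/
def IsJordanDomain (Ω : Set E2) : Prop :=
  IsOpen Ω ∧ IsConnected Ω ∧ Bornology.IsBounded Ω ∧ IsJordanCurve (frontier Ω)

/-- The ε-level set γ_ε = {x ∈ Ω : dist(x,∂Ω) = ε}, with the convention γ₀ = ∂Ω. -/
def levelSet (Ω : Set E2) (ε : ℝ) : Set E2 :=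
  if ε = 0 then frontier Ω else {x ∈ Ω | infDist x (frontier Ω) = ε}

/-- The double-dome-like surface Σ(Ω,φ). -/
def domeSurface (Ω : Set E2) (φ : ℝ → ℝ) : Set E3 :=
  {p | ∃ x ∈ closure Ω, p = mk3 x (φ (infDist x (frontier Ω))) ∨
                        p = mk3 x (-φ (infDist x (frontier Ω)))}

/-- The class 𝓕 of gauges: homeomorphisms φ of [0,∞) onto [0,∞) with φ(0)=0,
liminf_{t→0} φ(t)/t > 0, and φ Lipschitz on [r,∞) for every r > 0. -/
structure GaugeF (φ : ℝ → ℝ) : Prop where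
  continuousOn : ContinuousOn φ (Ici 0)
  strictMonoOn : StrictMonoOn φ (Ici 0)
  surjOn : SurjOn φ (Ici 0) (Ici 0)
  map_zero : φ 0 = 0
  liminf_pos : ∃ m > (0:ℝ), ∀ᶠ t in nhdsWithin 0 (Ioi 0), m * t ≤ φ t
  lipschitzOn : ∀ r > (0:ℝ), ∃ L : NNReal, LipschitzOnWith L φ (Ici r)

/-- A subarc of Γ with endpoints x and y: a subset of Γ that is a simple arc from x to y. -/
def IsSubarc (Γ A : Set E2) (x y : E2) : Prop :=
  A ⊆ Γ ∧ ∃ f : ℝ → E2, ContinuousOn f (Icc 0 1) ∧ InjOn f (Icc 0 1) ∧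
    f 0 = x ∧ f 1 = y ∧ f '' (Icc 0 1) = A

/-- The 2-point condition with constant C: for any two points of Γ, some subarc joining
them (hence the one of smaller diameter) has diameter at most C·|x−y|. -/
def TwoPointCondition (Γ : Set E2) (C : ℝ) : Prop :=
  ∀ x ∈ Γ, ∀ y ∈ Γ, x ≠ y →
    ∃ A, IsSubarc Γ A x y ∧ Metric.diam A ≤ C * dist x y

/-- A c-chord-arc curve: a rectifiable Jordan curve such that for any two points, the
shorter subarc joining them has length (1-dimensional Hausdorff measure) at most c·|x−y|. -/
def IsChordArc (Γ : Set E2) (c : ℝ) : Prop :=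
  IsJordanCurve Γ ∧ μH[1] Γ < ⊤ ∧
  ∀ x ∈ Γ, ∀ y ∈ Γ, x ≠ y →
    ∃ A, IsSubarc Γ A x y ∧ μH[1] A ≤ ENNReal.ofReal (c * dist x y)

/-- The λ-LLC₁ condition. -/
def LLC1With {X : Type*} [MetricSpace X] (S : Set X) (lam : ℝ) : Prop :=
  ∀ x ∈ S, ∀ r > (0:ℝ), ∀ y₁ ∈ ball x r ∩ S, ∀ y₂ ∈ ball x r ∩ S,
    ∃ E ⊆ ball x (lam * r) ∩ S, IsCompact E ∧ IsConnected E ∧ y₁ ∈ E ∧ y₂ ∈ E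

/-- The λ-LLC₂ condition. -/
def LLC2With {X : Type*} [MetricSpace X] (S : Set X) (lam : ℝ) : Prop :=
  ∀ x ∈ S, ∀ r > (0:ℝ), ∀ y₁ ∈ S \ ball x r, ∀ y₂ ∈ S \ ball x r,
    ∃ E ⊆ S \ ball x (r / lam), IsCompact E ∧ IsConnected E ∧ y₁ ∈ E ∧ y₂ ∈ E

/-- λ-linear local connectivity. -/
def LLCWith {X : Type*} [MetricSpace X] (S : Set X) (lam : ℝ) : Prop :=
  LLC1With S lam ∧ LLC2With S lam

/-- S (with the Euclidean metric of ℝ³) is quasisymmetric to the unit sphere S²: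
there are a homeomorphism η of [0,∞) onto itself and an η-quasisymmetric
homeomorphism of S onto the unit sphere. -/
def QSEquivSphere (S : Set E3) : Prop :=
  ∃ η : ℝ → ℝ, (ContinuousOn η (Ici 0) ∧ StrictMonoOn η (Ici 0) ∧ SurjOn η (Ici 0) (Ici 0)) ∧
  ∃ f : S → (sphere (0:E3) 1 : Set E3), Function.Bijective f ∧
    ∀ (x a b : S) (t : ℝ), 0 < t → dist (x:E3) a ≤ t * dist (x:E3) b →
      dist (f x : E3) (f a) ≤ η t * dist (f x : E3) (f b)

/-- The level chord-arc property. -/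
def LevelChordArc (Ω : Set E2) : Prop :=
  ∃ ε₀ > (0:ℝ), ∃ c > (1:ℝ), ∀ ε, 0 ≤ ε → ε ≤ ε₀ → IsChordArc (levelSet Ω ε) c

/-- The level quasicircle property. -/
def LevelQuasicircle (Ω : Set E2) : Prop :=
  ∃ ε₀ > (0:ℝ), ∃ C > (1:ℝ), ∀ ε, 0 ≤ ε → ε ≤ ε₀ →
    IsJordanCurve (levelSet Ω ε) ∧ TwoPointCondition (levelSet Ω ε) C

/-! ### Hausdorff measure of connected sets -/

/-- A connected set reaching from `p` to distance `ρ` has length at least `ρ` inside `ball p ρ`. -/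
lemma ofReal_le_hausdorffMeasure_inter_ball {X : Type*} [MetricSpace X] [MeasurableSpace X]
    [BorelSpace X] {A : Set X} (hA : IsPreconnected A) {p q : X} (hp : p ∈ A) (hq : q ∈ A)
    {ρ : ℝ} (hρ : ρ ≤ dist p q) : ENNReal.ofReal ρ ≤ μH[1] (A ∩ ball p ρ) := by
  have hsub : Ico 0 ρ ⊆ (fun z => dist z p) '' (A ∩ ball p ρ) := by
    intro t ht
    have hI := (hA.image (fun z => dist z p) (by fun_prop)).ordConnected.out
      (mem_image_of_mem _ hp) (mem_image_of_mem _ hq)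
    obtain ⟨z, hz, hzt⟩ := hI (show t ∈ Icc (dist p p) (dist q p) by
      rw [dist_self, dist_comm q p]; exact ⟨ht.1, ht.2.le.trans hρ⟩)
    exact ⟨z, ⟨hz, by rw [mem_ball]; exact hzt.trans_lt ht.2⟩, hzt⟩
  have hl : LipschitzWith 1 (fun z : X => dist z p) := LipschitzWith.dist_left p
  calc ENNReal.ofReal ρ = μH[1] (Ico 0 ρ) := by rw [hausdorffMeasure_real]; simp
    _ ≤ μH[1] ((fun z => dist z p) '' (A ∩ ball p ρ)) := measure_mono hsub
    _ ≤ μH[1] (A ∩ ball p ρ) := by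
      simpa using hl.hausdorffMeasure_image_le zero_le_one (A ∩ ball p ρ)

/-- A connected set of finite length contains few separated points. -/
lemma card_le_of_separated_of_isPreconnected {X : Type*} [MetricSpace X] [MeasurableSpace X]
    [BorelSpace X] {A : Set X} (hA : IsPreconnected A) {ε L : ℝ} (hε : 0 < ε) (hL : 0 ≤ L)
    (hAL : μH[1] A ≤ ENNReal.ofReal L) (F : Finset X) (hF : ↑F ⊆ A)
    (hsep : (F : Set X).Pairwise fun p q => ε ≤ dist p q) : (F.card : ℝ) ≤ 1 + 2 * L / ε := by
  have hq : 0 ≤ 2 * L / ε := by positivity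
  rcases le_or_gt F.card 1 with h | h
  · have : (F.card : ℝ) ≤ 1 := by exact_mod_cast h
    linarith
  have h1 : ∀ p ∈ F, ENNReal.ofReal (ε / 2) ≤ (μH[1]).restrict A (ball p (ε / 2)) := by
    intro p hp
    obtain ⟨q, hq, hqp⟩ := Finset.exists_mem_ne h p
    rw [Measure.restrict_apply measurableSet_ball, inter_comm]
    refine ofReal_le_hausdorffMeasure_inter_ball hA (hF hp) (hF hq) ?_
    have := hsep hp hq hqp.symm
    linarith
  have h2 : ∑ p ∈ F, (μH[1]).restrict A (ball p (ε / 2)) ≤ (μH[1]).restrict A univ := by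
    refine sum_measure_le_measure_univ (fun p _ => measurableSet_ball.nullMeasurableSet) ?_
    intro p hp q hq hpq
    refine (ball_disjoint_ball ?_).aedisjoint
    have := hsep hp hq hpq
    linarith
  have h3 : ENNReal.ofReal (F.card * (ε / 2)) ≤ ENNReal.ofReal L := by
    calc ENNReal.ofReal (F.card * (ε / 2)) = ∑ p ∈ F, ENNReal.ofReal (ε / 2) := by
          rw [Finset.sum_const, nsmul_eq_mul, ENNReal.ofReal_mul (by positivity),
            ENNReal.ofReal_natCast]
      _ ≤ _ := Finset.sum_le_sum h1
      _ ≤ _ := h2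
      _ ≤ _ := by rw [Measure.restrict_apply_univ]; exact hAL
  have h4 := (ENNReal.ofReal_le_ofReal_iff hL).1 h3
  have : (F.card : ℝ) ≤ 2 * L / ε := by rw [le_div_iff₀ hε]; linarith
  linarith

/-- If separated subsets of `S` have bounded cardinality, a largest one is an `ε`-net of `S`. -/
lemma exists_separated_net {X : Type*} [MetricSpace X] {S : Set X} {ε N : ℝ} (hε : 0 < ε)
    (hN : ∀ F : Finset X, ↑F ⊆ S → ((F : Set X).Pairwise fun p q => ε ≤ dist p q) →
      (F.card : ℝ) ≤ N) :
    ∃ F : Finset X, ↑F ⊆ S ∧ (F.card : ℝ) ≤ N ∧ ∀ p ∈ S, ∃ q ∈ F, dist p q < ε := by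
  classical
  let T : Set ℕ := {n | ∃ F : Finset X, ↑F ⊆ S ∧
    ((F : Set X).Pairwise fun p q => ε ≤ dist p q) ∧ F.card = n}
  have hT : T.Nonempty := ⟨0, ∅, by simp, by simp, rfl⟩
  have hTb : BddAbove T := by
    refine ⟨⌊N⌋₊, ?_⟩
    rintro n ⟨F, hF, hs, rfl⟩
    exact Nat.le_floor (hN F hF hs)
  obtain ⟨F, hF, hs, hc⟩ := Nat.sSup_mem hT hTb
  refine ⟨F, hF, hN F hF hs, fun p hp => ?_⟩
  by_contra! hcon
  have hpF : p ∉ F := fun hpF => hε.not_ge (by simpa using hcon p hpF)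
  have hmem : F.card + 1 ∈ T := by
    refine ⟨insert p F, ?_, ?_, Finset.card_insert_of_notMem hpF⟩
    · rw [Finset.coe_insert]; exact insert_subset hp hF
    · rw [Finset.coe_insert]
      refine hs.insert fun q hq _ => ⟨hcon q hq, ?_⟩
      rw [dist_comm]; exact hcon q hq
  have := le_csSup hTb hmem
  omega

/-! ### Parametrizing a Jordan curve from a base point -/

lemma IsJordanCurve.exists_loop {Γ : Set E2} (h : IsJordanCurve Γ) {x : E2} (hx : x ∈ Γ) :
    ∃ g : ℝ → E2, Continuous g ∧ InjOn g (Ico 0 1) ∧ g 0 = x ∧ g 1 = x ∧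
      g '' Icc 0 1 = Γ := by
  obtain ⟨f, hfc, hfi, rfl⟩ := h
  obtain ⟨z, hz, rfl⟩ := hx
  let L : ℂ ≃ₗᵢ[ℝ] E2 := Complex.orthonormalBasisOneI.repr
  have hLs : ∀ w : Circle, L w ∈ sphere (0 : E2) 1 := fun w => by
    simp [Circle.norm_coe]
  have hsurj : ∀ y ∈ sphere (0 : E2) 1, ∃ θ : ℝ, L (Circle.exp θ) = y := by
    intro y hy
    have hy' : L.symm y ∈ sphere (0 : ℂ) 1 := by simpa using hy
    obtain ⟨θ, hθ⟩ := Circle.exp_surjective ⟨L.symm y, hy'⟩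
    exact ⟨θ, by rw [hθ]; simp⟩
  obtain ⟨θ, hθ⟩ := hsurj z hz
  have hpi := Real.two_pi_pos
  refine ⟨fun t => f (L (Circle.exp (θ + t * (2 * Real.pi)))), ?_, ?_, ?_, ?_, ?_⟩
  · exact hfc.comp_continuous (by fun_prop) fun t => hLs _
  · intro s hs t ht hst
    have h1 := L.injective (hfi (hLs _) (hLs _) hst)
    have h2 := Circle.exp_injOn_Ico (a := θ) (b := θ + 2 * Real.pi) (by linarith)
      ⟨by nlinarith [hs.1], by nlinarith [hs.2]⟩ ⟨by nlinarith [ht.1], by nlinarith [ht.2]⟩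
      (Subtype.ext h1)
    have h3 : s * (2 * Real.pi) = t * (2 * Real.pi) := by linarith
    exact mul_right_cancel₀ hpi.ne' h3
  · simp only [zero_mul, add_zero, hθ]
  · simp only [one_mul, Circle.exp_add_two_pi, hθ]
  · ext y
    constructor
    · rintro ⟨t, -, rfl⟩
      exact ⟨_, hLs _, rfl⟩
    · rintro ⟨w, hw, rfl⟩
      obtain ⟨φ, hφ⟩ := hsurj w hw
      have hr : Circle.exp φ ∈ Circle.exp '' Icc θ (θ + 2 * Real.pi) := by
        rw [Circle.periodic_exp.image_Icc hpi]; exact mem_range_self _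
      obtain ⟨ψ, hψ, hψe⟩ := hr
      refine ⟨(ψ - θ) / (2 * Real.pi), ⟨?_, ?_⟩, ?_⟩
      · exact div_nonneg (by linarith [hψ.1]) hpi.le
      · rw [div_le_one hpi]; linarith [hψ.2]
      · dsimp only
        rw [div_mul_cancel₀ _ hpi.ne', add_sub_cancel, hψe, hφ]

/-- A connected subset of a simple loop joining the base point to `g t` contains one of the two
arcs of the loop between these points. -/
lemma image_Icc_subset_or_of_isPreconnected {X : Type*} [TopologicalSpace X] [T2Space X]
    {g : ℝ → X} (hg : Continuous g) (hi : InjOn g (Ico 0 1)) (h01 : g 0 = g 1) {A : Set X}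
    (hA : IsPreconnected A) (hAg : A ⊆ g '' Icc 0 1) {t : ℝ}
    (h0 : g 0 ∈ A) (hgt : g t ∈ A) : g '' Icc 0 t ⊆ A ∨ g '' Icc t 1 ⊆ A := by
  by_contra! hcon
  simp only [not_subset] at hcon
  obtain ⟨⟨_, ⟨a, ha, rfl⟩, haA⟩, ⟨_, ⟨b, hb, rfl⟩, hbA⟩⟩ := hcon
  have ha0 : 0 < a := lt_of_le_of_ne ha.1 fun h => haA (h ▸ h0)
  have hat : a < t := lt_of_le_of_ne ha.2 fun h => haA (h ▸ hgt)
  have htb : t < b := lt_of_le_of_ne hb.1 fun h => hbA (h ▸ hgt)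
  have hb1 : b < 1 := lt_of_le_of_ne hb.2 fun h => hbA (h ▸ h01 ▸ h0)
  have hcl : ∀ u v, IsClosed (g '' Icc u v) := fun u v => (isCompact_Icc.image hg).isClosed
  obtain ⟨p, hpA, ⟨s, hs, rfl⟩, hp⟩ := isPreconnected_closed_iff.1 hA (g '' Icc a b)
    (g '' Icc 0 a ∪ g '' Icc b 1) (hcl _ _) ((hcl _ _).union (hcl _ _)) (by
      intro p hp
      obtain ⟨s, hs, rfl⟩ := hAg hp
      rcases le_total s a with h | h
      · exact Or.inr (Or.inl ⟨s, ⟨hs.1, h⟩, rfl⟩)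
      rcases le_total s b with h' | h'
      · exact Or.inl ⟨s, ⟨h, h'⟩, rfl⟩
      · exact Or.inr (Or.inr ⟨s, ⟨h', hs.2⟩, rfl⟩))
    ⟨g t, hgt, t, ⟨hat.le, htb.le⟩, rfl⟩ ⟨g 0, h0, Or.inl ⟨0, ⟨le_rfl, ha0.le⟩, rfl⟩⟩
  have hsI : s ∈ Ico (0 : ℝ) 1 := ⟨ha0.le.trans hs.1, hs.2.trans_lt hb1⟩
  rcases hp with ⟨r, hr, hrs⟩ | ⟨r, hr, hrs⟩
  · have hrs' := hi ⟨hr.1, by linarith [hr.2]⟩ hsI hrs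
    have : s = a := le_antisymm (hrs' ▸ hr.2) hs.1
    exact haA (this ▸ hpA)
  · rcases hr.2.lt_or_eq with h | h
    · have hrs' := hi ⟨by linarith [hr.1], h⟩ hsI hrs
      have : s = b := le_antisymm hs.2 (hrs' ▸ hr.1)
      exact hbA (this ▸ hpA)
    · rw [h, ← h01] at hrs
      have hrs' := hi ⟨le_rfl, one_pos⟩ hsI hrs
      linarith [hs.1]

/-! ### Subarcs -/

lemma IsSubarc.isCompact {Γ A : Set E2} {x y : E2} (h : IsSubarc Γ A x y) : IsCompact A := by
  obtain ⟨-, f, hf, -, -, -, rfl⟩ := h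
  exact isCompact_Icc.image_of_continuousOn hf

lemma IsSubarc.isPreconnected {Γ A : Set E2} {x y : E2} (h : IsSubarc Γ A x y) :
    IsPreconnected A := by
  obtain ⟨-, f, hf, -, -, -, rfl⟩ := h
  exact isPreconnected_Icc.image _ hf

lemma IsSubarc.left_mem {Γ A : Set E2} {x y : E2} (h : IsSubarc Γ A x y) : x ∈ A := by
  obtain ⟨-, f, -, -, rfl, -, rfl⟩ := h
  exact mem_image_of_mem _ (by simp)

lemma IsSubarc.right_mem {Γ A : Set E2} {x y : E2} (h : IsSubarc Γ A x y) : y ∈ A := by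
  obtain ⟨-, f, -, -, -, rfl, rfl⟩ := h
  exact mem_image_of_mem _ (by simp)

lemma IsJordanCurve.isCompact {Γ : Set E2} (h : IsJordanCurve Γ) : IsCompact Γ := by
  obtain ⟨f, hf, -, rfl⟩ := h
  exact (isCompact_sphere 0 1).image_of_continuousOn hf

lemma IsChordArc.twoPointCondition {Γ : Set E2} {c : ℝ} (hc : 0 ≤ c) (h : IsChordArc Γ c) :
    TwoPointCondition Γ c := by
  intro x hx y hy hxy
  obtain ⟨A, hA, hAm⟩ := h.2.2 x hx y hy hxy
  refine ⟨A, hA, diam_le_of_forall_dist_le (by positivity) fun p hp q hq => ?_⟩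
  refine (ENNReal.ofReal_le_ofReal_iff (by positivity)).1 ?_
  exact (ofReal_le_hausdorffMeasure_inter_ball hA.isPreconnected hp hq le_rfl).trans
    ((measure_mono inter_subset_left).trans hAm)

/-- Separated subsets of a chord-arc curve in a ball have at most linearly many points. -/
lemma IsChordArc.card_le_of_separated {Γ : Set E2} {c : ℝ} (hc : 0 ≤ c) (h : IsChordArc Γ c)
    {x : E2} (hx : x ∈ Γ) {ε s : ℝ} (hε : 0 < ε) (hs : 0 ≤ s) (F : Finset E2)
    (hF : ↑F ⊆ Γ ∩ closedBall x s)
    (hsep : (F : Set E2).Pairwise fun p q => ε ≤ dist p q) :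
    (F.card : ℝ) ≤ 2 * (1 + 2 * (c * s) / ε) := by
  classical
  obtain ⟨g, hg, hi, rfl, h1, hgΓ⟩ := h.1.exists_loop hx
  have hcs : 0 ≤ c * s := by positivity
  have key : ∀ p ∈ F, ∃ t ∈ Icc (0 : ℝ) 1, g t = p ∧
      (μH[1] (g '' Icc 0 t) ≤ ENNReal.ofReal (c * s) ∨
        μH[1] (g '' Icc t 1) ≤ ENNReal.ofReal (c * s)) := by
    intro p hp
    obtain ⟨hpΓ, hps⟩ := hF hp
    rcases eq_or_ne (g 0) p with rfl | hne
    · refine ⟨0, by simp, rfl, Or.inl ?_⟩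
      have := Measure.nullSingletonClass_hausdorff E2 one_pos
      rw [Icc_self, image_singleton, measure_singleton]
      exact zero_le
    · rw [← hgΓ] at hpΓ
      obtain ⟨t, ht, rfl⟩ := hpΓ
      obtain ⟨A, hA, hAm⟩ := h.2.2 (g 0) hx (g t) (hgΓ ▸ mem_image_of_mem g ht) hne
      have hAs : μH[1] A ≤ ENNReal.ofReal (c * s) := by
        refine hAm.trans (ENNReal.ofReal_le_ofReal ?_)
        rw [mem_closedBall, dist_comm] at hps
        gcongr
      refine ⟨t, ht, rfl, ?_⟩
      exact (image_Icc_subset_or_of_isPreconnected hg hi h1.symm hA.isPreconnected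
        (hgΓ ▸ hA.1) hA.left_mem hA.right_mem).imp
        (fun h => (measure_mono h).trans hAs) (fun h => (measure_mono h).trans hAs)
  choose! τ hτI hτ hτm using key
  let P : E2 → Prop := fun p => μH[1] (g '' Icc 0 (τ p)) ≤ ENNReal.ofReal (c * s)
  have hleft : ((F.filter P).card : ℝ) ≤ 1 + 2 * (c * s) / ε := by
    rcases (F.filter P).eq_empty_or_nonempty with he | hne
    · rw [he]; simp; positivity
    obtain ⟨m, hm, hmax⟩ := (F.filter P).exists_max_image τ hne
    refine card_le_of_separated_of_isPreconnected
      (isPreconnected_Icc.image _ hg.continuousOn) hε hcs (Finset.mem_filter.1 hm).2 _ ?_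
      (hsep.mono (Finset.coe_subset.2 (Finset.filter_subset _ _)))
    intro p hp
    have hpF := (Finset.mem_filter.1 hp).1
    exact ⟨τ p, ⟨(hτI p hpF).1, hmax p hp⟩, hτ p hpF⟩
  have hright : ((F.filter fun p => ¬ P p).card : ℝ) ≤ 1 + 2 * (c * s) / ε := by
    rcases (F.filter fun p => ¬ P p).eq_empty_or_nonempty with he | hne
    · rw [he]; simp; positivity
    obtain ⟨m, hm, hmin⟩ := (F.filter fun p => ¬ P p).exists_min_image τ hne
    obtain ⟨hmF, hmP⟩ := Finset.mem_filter.1 hm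
    refine card_le_of_separated_of_isPreconnected
      (isPreconnected_Icc.image _ hg.continuousOn) hε hcs ((hτm m hmF).resolve_left hmP) _ ?_
      (hsep.mono (Finset.coe_subset.2 (Finset.filter_subset _ _)))
    intro p hp
    have hpF := (Finset.mem_filter.1 hp).1
    exact ⟨τ p, ⟨hmin p hp, (hτI p hpF).2⟩, hτ p hpF⟩
  have hcard : ((F.filter P).card : ℝ) + ((F.filter fun p => ¬ P p).card : ℝ) = F.card := by
    exact_mod_cast Finset.card_filter_add_card_filter_not (s := F) P
  linarith

/-! ### Length of level sets of the distance function -/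

/-- A planar set on which chords make a definite angle with the unit vector `e` is a Lipschitz
graph over the line orthogonal to `e`. -/
lemma hausdorffMeasure_le_of_inner_le {S : Set E2} {e z : E2} {r : ℝ} (hr : 0 ≤ r)
    (he : ‖e‖ = 1) (hS : S ⊆ closedBall z r)
    (hchord : ∀ p ∈ S, ∀ q ∈ S, |inner ℝ (p - q) e| ≤ 1 / 2 * dist p q) :
    μH[1] S ≤ ENNReal.ofReal (4 * r) := by
  let π : E2 → ℝ := fun p => e 0 * p 1 - e 1 * p 0
  have he2 : e 0 ^ 2 + e 1 ^ 2 = 1 := by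
    have := EuclideanSpace.real_norm_sq_eq e
    rw [he, Fin.sum_univ_two] at this
    linarith
  have hid : ∀ p q : E2, dist p q ^ 2 = inner ℝ (p - q) e ^ 2 + (π p - π q) ^ 2 := by
    intro p q
    rw [dist_eq_norm, EuclideanSpace.real_norm_sq_eq, Fin.sum_univ_two, PiLp.inner_apply,
      Fin.sum_univ_two]
    simp only [PiLp.sub_apply, RCLike.inner_apply, conj_trivial, π]
    linear_combination -((p 0 - q 0) ^ 2 + (p 1 - q 1) ^ 2) * he2
  have hanti : ∀ p ∈ S, ∀ q ∈ S, dist p q ≤ 2 * dist (π p) (π q) := by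
    intro p hp q hq
    have h1 := hchord p hp q hq
    have h2 := hid p q
    have h3 : inner ℝ (p - q) e ^ 2 ≤ (1 / 2 * dist p q) ^ 2 :=
      sq_le_sq' (abs_le.1 h1).1 (abs_le.1 h1).2
    refine abs_le_of_sq_le_sq' ?_ (by positivity) |>.2
    rw [mul_pow, Real.dist_eq, sq_abs]
    nlinarith [sq_nonneg (π p - π q)]
  have hinj : InjOn π S := by
    intro p hp q hq hpq
    have := hanti p hp q hq
    rw [hpq, dist_self, mul_zero] at this
    exact dist_le_zero.1 this
  have hlip : LipschitzOnWith 2 (Function.invFunOn π S) (π '' S) := by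
    refine LipschitzOnWith.of_dist_le_mul ?_
    rintro _ ⟨p, hp, rfl⟩ _ ⟨q, hq, rfl⟩
    rw [hinj.leftInvOn_invFunOn hp, hinj.leftInvOn_invFunOn hq]
    exact hanti p hp q hq
  have himg : π '' S ⊆ closedBall (π z) r := by
    rintro _ ⟨p, hp, rfl⟩
    have h1 := hid p z
    have h2 : dist p z ≤ r := hS hp
    rw [mem_closedBall, Real.dist_eq]
    refine abs_le_of_sq_le_sq ?_ hr
    nlinarith [sq_nonneg (inner ℝ (p - z) e : ℝ), dist_nonneg (x := p) (y := z)]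
  calc μH[1] S = μH[1] (Function.invFunOn π S '' (π '' S)) := by
        rw [hinj.leftInvOn_invFunOn.image_image]
    _ ≤ 2 * μH[1] (π '' S) := by
        simpa using hlip.hausdorffMeasure_image_le zero_le_one
    _ ≤ 2 * μH[1] (closedBall (π z) r) := by gcongr
    _ = ENNReal.ofReal (4 * r) := by
        rw [hausdorffMeasure_real, Real.volume_closedBall, ← ENNReal.ofReal_ofNat 2,
          ← ENNReal.ofReal_mul (by norm_num)]
        congr 1; ring

/-- Moving from a point `p` at distance `ε` from `K` to another point of the same level set, one
cannot move far towards the nearest point `q`. -/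
lemma neg_le_inner_of_infDist_eq {K : Set E2} {ε : ℝ} (hε : 0 < ε) {p p' q : E2} (hq : q ∈ K)
    (hpq : dist p q = ε) (hp' : infDist p' K = ε) (hpp : dist p' p ≤ ε / 2) :
    -(1 / 4 * dist p' p) ≤ inner ℝ (p' - p) (ε⁻¹ • (p - q)) := by
  have h1 : ε ≤ dist p' q := hp' ▸ infDist_le_dist_of_mem hq
  have h2 : dist p' q ^ 2 = dist p' p ^ 2 + 2 * inner ℝ (p' - p) (p - q) + ε ^ 2 := by
    rw [← hpq, dist_eq_norm, dist_eq_norm, dist_eq_norm, ← norm_add_sq_real]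
    simp
  have h3 : ε ^ 2 ≤ dist p' q ^ 2 := by gcongr
  have h4 : dist p' p ^ 2 ≤ dist p' p * (ε / 2) := by
    rw [sq]; gcongr
  rw [inner_smul_right, inv_mul_eq_div, le_div_iff₀ hε]
  nlinarith

/-- A level set of the distance function is, at scales below the level, covered by a bounded number
of Lipschitz graphs. -/
lemma exists_hausdorffMeasure_level_le_of_small :
    ∃ C : ℝ, 0 ≤ C ∧ ∀ (K : Set E2) (ε r : ℝ) (z : E2), IsCompact K → K.Nonempty → 0 < ε →
      0 ≤ r → r ≤ ε / 4 →
      μH[1] ({p | infDist p K = ε} ∩ closedBall z r) ≤ ENNReal.ofReal (C * r) := by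
  obtain ⟨D, hDs, hDf, hD⟩ := finite_cover_balls_of_compact (isCompact_sphere (0 : E2) 1)
    (show (0 : ℝ) < 1 / 4 by norm_num)
  lift D to Finset E2 using hDf
  refine ⟨D.card * 4, by positivity, fun K ε r z hK hKn hε hr hrε => ?_⟩
  let S : E2 → Set E2 := fun e => {p | infDist p K = ε ∧ p ∈ closedBall z r ∧
    ∃ q ∈ K, dist p q = ε ∧ dist (ε⁻¹ • (p - q)) e ≤ 1 / 4}
  have hcover : {p | infDist p K = ε} ∩ closedBall z r ⊆ ⋃ e ∈ D, S e := by
    rintro p ⟨hp, hpz⟩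
    obtain ⟨q, hq, hpq⟩ := hK.exists_infDist_eq_dist hKn p
    have hp' : dist p q = ε := hpq.symm.trans hp
    have hu : ε⁻¹ • (p - q) ∈ sphere (0 : E2) 1 := by
      rw [mem_sphere_zero_iff_norm, norm_smul, ← dist_eq_norm, hp', norm_inv, Real.norm_eq_abs,
        abs_of_pos hε, inv_mul_cancel₀ hε.ne']
    obtain ⟨e, he, hue⟩ := mem_iUnion₂.1 (hD hu)
    exact mem_iUnion₂.2 ⟨e, he, hp, hpz, q, hq, hp', (mem_ball.1 hue).le⟩
  have hle : ∀ e ∈ D, μH[1] (S e) ≤ ENNReal.ofReal (4 * r) := by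
    intro e he
    have hone : ∀ p ∈ S e, ∀ p' ∈ S e, -(1 / 2 * dist p' p) ≤ inner ℝ (p' - p) e := by
      rintro p ⟨-, hpz, q, hq, hpq, hqe⟩ p' ⟨hp', hpz', -⟩
      have hpp : dist p' p ≤ ε / 2 := by
        have := dist_triangle_right p' p z
        rw [mem_closedBall] at hpz hpz'
        linarith
      have h1 := neg_le_inner_of_infDist_eq hε hq hpq hp' hpp
      have h2 : inner ℝ (p' - p) (ε⁻¹ • (p - q) - e) ≤ dist p' p * (1 / 4) := by
        refine (real_inner_le_norm _ _).trans ?_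
        rw [← dist_eq_norm, ← dist_eq_norm]
        gcongr
      rw [inner_sub_right] at h2
      linarith
    refine hausdorffMeasure_le_of_inner_le hr (by simpa using hDs he) (fun p hp => hp.2.1) ?_
    intro p hp q hq
    have h1 := hone p hp q hq
    have h2 := hone q hq p hp
    rw [← neg_sub p q, inner_neg_left, dist_comm] at h1
    rw [abs_le]
    constructor <;> linarith
  calc _ ≤ _ := measure_mono hcover
    _ ≤ ∑ e ∈ D, μH[1] (S e) := measure_biUnion_finset_le D S
    _ ≤ ∑ e ∈ D, ENNReal.ofReal (4 * r) := Finset.sum_le_sum hle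
    _ = ENNReal.ofReal (D.card * 4 * r) := by
      rw [Finset.sum_const, nsmul_eq_mul, mul_assoc,
        ENNReal.ofReal_mul (p := (D.card : ℝ)) (by positivity),
        ENNReal.ofReal_natCast]

lemma exists_hausdorffMeasure_level_le_of_comparable :
    ∃ C : ℝ, 0 ≤ C ∧ ∀ (K : Set E2) (ε : ℝ) (z : E2), IsCompact K → K.Nonempty → 0 < ε →
      μH[1] ({p | infDist p K = ε} ∩ closedBall z (2 * ε)) ≤ ENNReal.ofReal (C * ε) := by
  obtain ⟨C, hC, hsmall⟩ := exists_hausdorffMeasure_level_le_of_small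
  obtain ⟨D, -, hDf, hD⟩ := finite_cover_balls_of_compact (isCompact_closedBall (0 : E2) 2)
    (show (0 : ℝ) < 1 / 4 by norm_num)
  lift D to Finset E2 using hDf
  refine ⟨D.card * (C / 4), by positivity, fun K ε z hK hKn hε => ?_⟩
  have hcover : {p | infDist p K = ε} ∩ closedBall z (2 * ε) ⊆
      ⋃ w ∈ D, ({p | infDist p K = ε} ∩ closedBall (z + ε • w) (ε / 4)) := by
    rintro p ⟨hp, hpz⟩
    have hu : ε⁻¹ • (p - z) ∈ closedBall (0 : E2) 2 := by
      rw [mem_closedBall_zero_iff, norm_smul, ← dist_eq_norm, norm_inv, Real.norm_eq_abs,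
        abs_of_pos hε, inv_mul_le_iff₀ hε, mul_comm]
      exact hpz
    obtain ⟨w, hw, huw⟩ := mem_iUnion₂.1 (hD hu)
    refine mem_iUnion₂.2 ⟨w, hw, hp, ?_⟩
    have heq : p - (z + ε • w) = ε • (ε⁻¹ • (p - z) - w) := by
      rw [smul_sub, smul_inv_smul₀ hε.ne', sub_add_eq_sub_sub]
    rw [mem_ball, dist_eq_norm] at huw
    rw [mem_closedBall, dist_eq_norm, heq, norm_smul, Real.norm_eq_abs, abs_of_pos hε]
    nlinarith
  calc _ ≤ _ := measure_mono hcover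
    _ ≤ ∑ w ∈ D, μH[1] ({p | infDist p K = ε} ∩ closedBall (z + ε • w) (ε / 4)) :=
      measure_biUnion_finset_le D _
    _ ≤ ∑ w ∈ D, ENNReal.ofReal (C * (ε / 4)) :=
      Finset.sum_le_sum fun w _ => hsmall K ε (ε / 4) _ hK hKn hε (by positivity) le_rfl
    _ = ENNReal.ofReal (D.card * (C / 4) * ε) := by
      rw [Finset.sum_const, nsmul_eq_mul, ← ENNReal.ofReal_natCast,
        ← ENNReal.ofReal_mul (by positivity)]
      congr 1; ring

/-- Level sets of the distance to a chord-arc curve are upper Ahlfors regular, uniformly in the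
level. -/
lemma IsChordArc.exists_hausdorffMeasure_level_le {Γ : Set E2} {c : ℝ} (hc : 0 ≤ c)
    (h : IsChordArc Γ c) :
    ∃ M : ℝ, 0 ≤ M ∧ ∀ (ε R : ℝ) (x : E2), 0 < ε → 0 ≤ R → infDist x Γ = ε →
      μH[1] ({p | infDist p Γ = ε} ∩ closedBall x R) ≤ ENNReal.ofReal (M * R) := by
  obtain ⟨C₁, hC₁, hsmall⟩ := exists_hausdorffMeasure_level_le_of_small
  obtain ⟨C₂, hC₂, hcomp⟩ := exists_hausdorffMeasure_level_le_of_comparable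
  refine ⟨C₁ + (8 + 36 * c) * C₂, by positivity, fun ε R x hε hR hx => ?_⟩
  have hK := h.1.isCompact
  have hKn : Γ.Nonempty := by
    rw [nonempty_iff_ne_empty]
    rintro rfl
    rw [infDist_empty] at hx
    exact hε.ne hx
  rcases le_or_gt R (ε / 4) with hRε | hRε
  · refine (hsmall Γ ε R x hK hKn hε hR hRε).trans (ENNReal.ofReal_le_ofReal ?_)
    have : 0 ≤ (8 + 36 * c) * C₂ * R := by positivity
    linarith
  obtain ⟨x', hx', hxx'⟩ := hK.exists_infDist_eq_dist hKn x
  rw [hx] at hxx'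
  obtain ⟨F, -, hFc, hF⟩ := exists_separated_net hε
    (h.card_le_of_separated hc hx' hε (show 0 ≤ 9 * R by positivity))
  have hcover : {p | infDist p Γ = ε} ∩ closedBall x R ⊆
      ⋃ f ∈ F, ({p | infDist p Γ = ε} ∩ closedBall f (2 * ε)) := by
    rintro p ⟨hp, hpx⟩
    obtain ⟨q, hq, hpq⟩ := hK.exists_infDist_eq_dist hKn p
    rw [show infDist p Γ = ε from hp] at hpq
    have hqx : q ∈ closedBall x' (9 * R) := by
      have h1 := dist_triangle4 q p x x'
      rw [mem_closedBall] at hpx ⊢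
      rw [dist_comm q p] at h1
      linarith
    obtain ⟨f, hf, hqf⟩ := hF q ⟨hq, hqx⟩
    refine mem_iUnion₂.2 ⟨f, hf, hp, ?_⟩
    have := dist_triangle p q f
    rw [mem_closedBall]
    linarith
  calc _ ≤ _ := measure_mono hcover
    _ ≤ ∑ f ∈ F, μH[1] ({p | infDist p Γ = ε} ∩ closedBall f (2 * ε)) :=
      measure_biUnion_finset_le F _
    _ ≤ ∑ f ∈ F, ENNReal.ofReal (C₂ * ε) :=
      Finset.sum_le_sum fun f _ => hcomp Γ ε f hK hKn hε
    _ = ENNReal.ofReal (F.card * (C₂ * ε)) := by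
      rw [Finset.sum_const, nsmul_eq_mul, ENNReal.ofReal_mul (p := (F.card : ℝ)) (by positivity),
        ENNReal.ofReal_natCast]
    _ ≤ ENNReal.ofReal ((C₁ + (8 + 36 * c) * C₂) * R) := by
      refine ENNReal.ofReal_le_ofReal ?_
      calc (F.card : ℝ) * (C₂ * ε) ≤ 2 * (1 + 2 * (c * (9 * R)) / ε) * (C₂ * ε) := by gcongr
        _ = C₂ * (2 * ε + 36 * c * R) := by field_simp; ring
        _ ≤ C₂ * (8 * R + 36 * c * R) := by
          refine mul_le_mul_of_nonneg_left ?_ hC₂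
          linarith
        _ ≤ _ := by nlinarith [mul_nonneg hC₁ hR]

lemma LevelChordArc.levelQuasicircle {Ω : Set E2} (h : LevelChordArc Ω) : LevelQuasicircle Ω := by
  obtain ⟨ε₀, hε₀, c, hc, h⟩ := h
  exact ⟨ε₀, hε₀, c, hc, fun ε h0 h1 =>
    ⟨(h ε h0 h1).1, (h ε h0 h1).twoPointCondition (by linarith)⟩⟩

lemma LevelQuasicircle.levelChordArc {Ω : Set E2} (h : LevelQuasicircle Ω) {c : ℝ} (hc : 1 < c)
    (hΓ : IsChordArc (frontier Ω) c) : LevelChordArc Ω := by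
  obtain ⟨ε₀, hε₀, C, hC, h⟩ := h
  obtain ⟨M, hM, hlevel⟩ := hΓ.exists_hausdorffMeasure_level_le (by linarith)
  have hMC : 0 ≤ M * C := by positivity
  refine ⟨ε₀, hε₀, c + M * C, by linarith, fun ε h0 h1 => ?_⟩
  rcases h0.eq_or_lt with rfl | hpos
  · rw [levelSet, if_pos rfl]
    refine ⟨hΓ.1, hΓ.2.1, fun x hx y hy hxy => ?_⟩
    obtain ⟨A, hA, hAm⟩ := hΓ.2.2 x hx y hy hxy
    refine ⟨A, hA, hAm.trans (ENNReal.ofReal_le_ofReal ?_)⟩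
    gcongr
    linarith
  obtain ⟨hJ, hT⟩ := h ε h0 h1
  have hsub : levelSet Ω ε ⊆ {p | infDist p (frontier Ω) = ε} := by
    rw [levelSet, if_neg hpos.ne']
    exact fun p hp => hp.2
  refine ⟨hJ, ?_, fun x hx y hy hxy => ?_⟩
  · rcases (levelSet Ω ε).eq_empty_or_nonempty with he | ⟨x, hx⟩
    · simp [he]
    have hb : levelSet Ω ε ⊆ closedBall x (diam (levelSet Ω ε)) := fun p hp =>
      dist_le_diam_of_mem hJ.isCompact.isBounded hp hx
    exact (measure_mono (subset_inter hsub hb)).trans_lt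
      ((hlevel ε _ x hpos diam_nonneg (hsub hx)).trans_lt ENNReal.ofReal_lt_top)
  · obtain ⟨A, hA, hAd⟩ := hT x hx y hy hxy
    refine ⟨A, hA, ?_⟩
    have hb : A ⊆ closedBall x (C * dist x y) := fun p hp =>
      (dist_le_diam_of_mem hA.isCompact.isBounded hp hA.left_mem).trans hAd
    refine ((measure_mono (subset_inter (hA.1.trans hsub) hb)).trans
      (hlevel ε _ x hpos (by positivity) (hsub hx))).trans (ENNReal.ofReal_le_ofReal ?_)
    nlinarith [dist_nonneg (x := x) (y := y)]

/-- Proposition 3.1: a Jordan domain has the level chord-arc property iff it has the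
level quasicircle property and its boundary is a chord-arc curve. -/
theorem stmt17 (Ω : Set E2) (hΩ : IsJordanDomain Ω) :
    LevelChordArc Ω ↔ (LevelQuasicircle Ω ∧ ∃ c > (1:ℝ), IsChordArc (frontier Ω) c) := by
  constructor
  · intro h
    refine ⟨h.levelQuasicircle, ?_⟩
    obtain ⟨ε₀, hε₀, c, hc, h⟩ := h
    exact ⟨c, hc, by simpa [levelSet] using h 0 le_rfl hε₀.le⟩
  · rintro ⟨h, c, hc, hΓ⟩
    exact h.levelChordArc hc hΓ
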